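/- Let ω, γ ∈ ℝ^{K−1} satisfy ω_i > 0, γ_i > 0 and ω_i γ_i < 1 for all i = 1,…,K−1. Let r^1, …, r^{K−1} be any choice with r^i ∈ {u^i, g^i}, and let n ∈ ℝ^K be defined by n_k = ∏_{i=1}^{K−1} d^i_k, where d^i_k = ω_i if r^i = u^i and k > i; d^i_k = 1 if r^i = u^i and k ≤ i; d^i_k = γ_i if r^i = g^i and k ≤ i; and d^i_k = 1 if r^i = g^i and k > i. Then for every i = 1,…,K−1: if r^i = u^i then n·g^i > 0, and if r^i = g^i then n·u^i > 0. -/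

import Mathlib

/- The number of ordered categories is `K + 1`; weight vectors `ω, γ` live in `ℝ^K`.
The choice `r^i ∈ {u^i, g^i}` is encoded by a selector `s : Fin K → Bool`, with
`r^i = u^i` when `s i = true` and `r^i = g^i` when `s i = false`.  The paper's
condition `k > i` (category index `k` vs. weight index `i`) reads `(i : ℕ) < (k : ℕ)`
and `k ≤ i` reads `(k : ℕ) ≤ (i : ℕ)`. -/

/-- `u^i = e_{i+1} − ω_i e_i`. -/
def uvec {K : ℕ} (ω : Fin K → ℝ) (i : Fin K) : Fin (K + 1) → ℝ :=
  (Pi.single i.succ 1 : Fin (K + 1) → ℝ) - ω i • (Pi.single i.castSucc 1 : Fin (K + 1) → ℝ)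

/-- `g^i = e_i − γ_i e_{i+1}`. -/
def gvec {K : ℕ} (γ : Fin K → ℝ) (i : Fin K) : Fin (K + 1) → ℝ :=
  (Pi.single i.castSucc 1 : Fin (K + 1) → ℝ) - γ i • (Pi.single i.succ 1 : Fin (K + 1) → ℝ)

/-- The factor `d^i_k`: `ω_i` if `r^i = u^i` and `k > i`; `1` if `r^i = u^i` and `k ≤ i`;
`γ_i` if `r^i = g^i` and `k ≤ i`; `1` if `r^i = g^i` and `k > i`. -/
def dfac {K : ℕ} (ω γ : Fin K → ℝ) (s : Fin K → Bool) (i : Fin K) (k : Fin (K + 1)) : ℝ :=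
  if s i then (if (i : ℕ) < (k : ℕ) then ω i else 1)
  else (if (k : ℕ) ≤ (i : ℕ) then γ i else 1)

/-- The normal vector `n` with `n_k = ∏_i d^i_k`. -/
def nvec {K : ℕ} (ω γ : Fin K → ℝ) (s : Fin K → Bool) (k : Fin (K + 1)) : ℝ :=
  ∏ i : Fin K, dfac ω γ s i k

lemma dfac_pos {K : ℕ} {ω γ : Fin K → ℝ} (hω : ∀ i, 0 < ω i) (hγ : ∀ i, 0 < γ i)
    (s : Fin K → Bool) (i : Fin K) (k : Fin (K + 1)) : 0 < dfac ω γ s i k := by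
  have := hω i
  have := hγ i
  unfold dfac
  split_ifs <;> first | assumption | exact one_pos

lemma nvec_pos {K : ℕ} {ω γ : Fin K → ℝ} (hω : ∀ i, 0 < ω i) (hγ : ∀ i, 0 < γ i)
    (s : Fin K → Bool) (k : Fin (K + 1)) : 0 < nvec ω γ s k :=
  Finset.prod_pos fun i _ => dfac_pos hω hγ s i k

/-- Only the `i`-th factor changes between coordinates `i` and `i + 1`. -/
lemma dfac_succ_eq_castSucc {K : ℕ} (ω γ : Fin K → ℝ) (s : Fin K → Bool) {i j : Fin K}
    (hj : j ≠ i) : dfac ω γ s j i.succ = dfac ω γ s j i.castSucc := by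
  have hne : (j : ℕ) ≠ i := Fin.val_ne_of_ne hj
  have hlt : (j : ℕ) < i + 1 ↔ (j : ℕ) < i := by omega
  have hle : (i : ℕ) + 1 ≤ j ↔ (i : ℕ) ≤ j := by omega
  simp only [dfac, Fin.val_succ, Fin.val_castSucc, hlt, hle]

lemma nvec_eq_mul_prod_erase {K : ℕ} (ω γ : Fin K → ℝ) (s : Fin K → Bool) (i : Fin K)
    (k : Fin (K + 1)) :
    nvec ω γ s k = dfac ω γ s i k * ∏ j ∈ Finset.univ.erase i, dfac ω γ s j k :=
  (Finset.mul_prod_erase _ _ (Finset.mem_univ i)).symm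

lemma prod_erase_dfac_succ {K : ℕ} (ω γ : Fin K → ℝ) (s : Fin K → Bool) (i : Fin K) :
    ∏ j ∈ Finset.univ.erase i, dfac ω γ s j i.succ =
      ∏ j ∈ Finset.univ.erase i, dfac ω γ s j i.castSucc :=
  Finset.prod_congr rfl fun _ hj => dfac_succ_eq_castSucc ω γ s (Finset.ne_of_mem_erase hj)

lemma nvec_succ_of_true {K : ℕ} (ω γ : Fin K → ℝ) (s : Fin K → Bool) {i : Fin K}
    (hi : s i = true) : nvec ω γ s i.succ = ω i * nvec ω γ s i.castSucc := by
  rw [nvec_eq_mul_prod_erase ω γ s i, nvec_eq_mul_prod_erase ω γ s i, prod_erase_dfac_succ]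
  simp [dfac, hi]

lemma nvec_castSucc_of_false {K : ℕ} (ω γ : Fin K → ℝ) (s : Fin K → Bool) {i : Fin K}
    (hi : s i = false) : nvec ω γ s i.castSucc = γ i * nvec ω γ s i.succ := by
  rw [nvec_eq_mul_prod_erase ω γ s i, nvec_eq_mul_prod_erase ω γ s i, prod_erase_dfac_succ]
  simp [dfac, hi]

lemma sum_mul_gvec {K : ℕ} (γ : Fin K → ℝ) (i : Fin K) (v : Fin (K + 1) → ℝ) :
    ∑ k, v k * gvec γ i k = v i.castSucc - γ i * v i.succ := by
  simp [gvec, mul_sub, Finset.sum_sub_distrib, Pi.single_apply, mul_comm]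

lemma sum_mul_uvec {K : ℕ} (ω : Fin K → ℝ) (i : Fin K) (v : Fin (K + 1) → ℝ) :
    ∑ k, v k * uvec ω i k = v i.succ - ω i * v i.castSucc := by
  simp [uvec, mul_sub, Finset.sum_sub_distrib, Pi.single_apply, mul_comm]

/-- For strictly positive weights with `ω_i γ_i < 1` and any choice `r^i ∈ {u^i, g^i}`,
the non-chosen rays lie strictly on the positive side of the hyperplane with normal `n`:
if `r^i = u^i` then `n·g^i > 0`, and if `r^i = g^i` then `n·u^i > 0`. -/
theorem nvec_strictly_positive_on_other_rays {K : ℕ} (hK : 1 ≤ K) (ω γ : Fin K → ℝ)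
    (hω : ∀ i, 0 < ω i) (hγ : ∀ i, 0 < γ i) (h1 : ∀ i, ω i * γ i < 1)
    (s : Fin K → Bool) :
    ∀ i : Fin K,
      (s i = true → 0 < ∑ k, nvec ω γ s k * gvec γ i k) ∧
      (s i = false → 0 < ∑ k, nvec ω γ s k * uvec ω i k) := by
  intro i
  refine ⟨fun hi => ?_, fun hi => ?_⟩
  · rw [sum_mul_gvec, nvec_succ_of_true ω γ s hi]
    nlinarith [mul_pos (sub_pos.2 (h1 i)) (nvec_pos hω hγ s i.castSucc)]
  · rw [sum_mul_uvec, nvec_castSucc_of_false ω γ s hi]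
    nlinarith [mul_pos (sub_pos.2 (h1 i)) (nvec_pos hω hγ s i.succ)]
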